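/- arXiv:2110.12582 — 8 statements merged into one kernel-verified Lean document; each statement's English description precedes it below -/
import Mathlib

section
/- If σ₁ > 0, σ₂ > 0 and |ρ| ≤ 1, then the function (w₁, w₂) ↦ σ_D²(w₁, w₂) is strictly convex on ℝ². -/
/-- (w₁, w₂) ↦ σ_D²(w₁, w₂) is strictly convex on ℝ² when σ₁ > 0, σ₂ > 0, |ρ| ≤ 1. -/
theorem sigmaD_sq_strictConvexOn (p₁ p₂ p₁₂ σ₁ σ₂ ρ : ℝ)
    (hp₁₂pos : 0 < p₁₂) (hp₁₂lt₁ : p₁₂ < p₁) (hp₁le : p₁ ≤ 1)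
    (hp₁₂lt₂ : p₁₂ < p₂) (hp₂le : p₂ ≤ 1)
    (hσ₁ : 0 < σ₁) (hσ₂ : 0 < σ₂) (hρ : |ρ| ≤ 1) :
    StrictConvexOn ℝ (Set.univ : Set (ℝ × ℝ)) (fun w : ℝ × ℝ =>
      (w.1 ^ 2 / p₁₂ + (1 - w.1) ^ 2 / (p₁ - p₁₂)) * σ₁ ^ 2
        + (w.2 ^ 2 / p₁₂ + (1 - w.2) ^ 2 / (p₂ - p₁₂)) * σ₂ ^ 2
        - 2 * w.1 * w.2 * ρ * σ₁ * σ₂ / p₁₂) := by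
  refine ⟨convex_univ, ?_⟩
  rintro ⟨x1, x2⟩ - ⟨y1, y2⟩ - hne a b ha hb hab
  obtain ⟨hr1, hr2⟩ := abs_le.mp hρ
  have hA : 0 < p₁₂⁻¹ := inv_pos.mpr hp₁₂pos
  have hB : 0 < (p₁ - p₁₂)⁻¹ := inv_pos.mpr (sub_pos.mpr hp₁₂lt₁)
  have hC : 0 < (p₂ - p₁₂)⁻¹ := inv_pos.mpr (sub_pos.mpr hp₁₂lt₂)
  simp only [Prod.smul_mk, Prod.mk_add_mk, smul_eq_mul, div_eq_mul_inv]
  generalize p₁₂⁻¹ = A at *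
  generalize (p₁ - p₁₂)⁻¹ = B at *
  generalize (p₂ - p₁₂)⁻¹ = C at *
  have h1 : 0 ≤ (σ₁ * (x1 - y1)) ^ 2 + (σ₂ * (x2 - y2)) ^ 2
      - 2 * ρ * (σ₁ * (x1 - y1)) * (σ₂ * (x2 - y2)) := by
    generalize σ₁ * (x1 - y1) = u
    generalize σ₂ * (x2 - y2) = v
    nlinarith [mul_nonneg (sub_nonneg.mpr hr2) (sq_nonneg (u + v)),
      mul_nonneg (neg_le_iff_add_nonneg.mp hr1) (sq_nonneg (u - v))]
  have h2 : 0 < B * (σ₁ * (x1 - y1)) ^ 2 + C * (σ₂ * (x2 - y2)) ^ 2 := by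
    by_cases hx : x1 = y1
    · have hy : x2 - y2 ≠ 0 := fun h => hne (by rw [hx, sub_eq_zero.mp h])
      have : 0 < C * (σ₂ * (x2 - y2)) ^ 2 := by positivity
      have : 0 ≤ B * (σ₁ * (x1 - y1)) ^ 2 := by positivity
      linarith
    · have hy : x1 - y1 ≠ 0 := sub_ne_zero.mpr hx
      have : 0 < B * (σ₁ * (x1 - y1)) ^ 2 := by positivity
      have : 0 ≤ C * (σ₂ * (x2 - y2)) ^ 2 := by positivity
      linarith
  have h3 := mul_pos (mul_pos ha hb) (add_pos_of_nonneg_of_pos (mul_nonneg hA.le h1) h2)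
  obtain rfl : b = 1 - a := by linarith
  rw [← sub_pos]
  refine lt_of_lt_of_eq h3 ?_
  ring
end

section
/- If σ₁ > 0, σ₂ > 0 and |ρ| ≤ 1, then both partial derivatives of (w₁, w₂) ↦ σ_D²(w₁, w₂) vanish at the point (w₁*, w₂*); in particular the denominators p₁p₂σ₁² - ρ²σ₁²(p₁-p₁₂)(p₂-p₁₂) and p₁p₂σ₂² - ρ²σ₂²(p₁-p₁₂)(p₂-p₁₂) are strictly positive. -/
/-- both partial derivatives of σ_D² vanish at (w₁*, w₂*); in particular the
denominators in the definitions of w₁* and w₂* are strictly positive. -/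
theorem sigmaD_sq_deriv_zero_at_wstar (p₁ p₂ p₁₂ σ₁ σ₂ ρ : ℝ)
    (hp₁₂pos : 0 < p₁₂) (hp₁₂lt₁ : p₁₂ < p₁) (hp₁le : p₁ ≤ 1)
    (hp₁₂lt₂ : p₁₂ < p₂) (hp₂le : p₂ ≤ 1)
    (hσ₁ : 0 < σ₁) (hσ₂ : 0 < σ₂) (hρ : |ρ| ≤ 1)
    (w₁s w₂s : ℝ)
    (hw₁s : w₁s = (p₂ * p₁₂ * σ₁ ^ 2 + ρ * σ₁ * σ₂ * p₁₂ * (p₁ - p₁₂))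
      / (p₁ * p₂ * σ₁ ^ 2 - ρ ^ 2 * σ₁ ^ 2 * (p₁ - p₁₂) * (p₂ - p₁₂)))
    (hw₂s : w₂s = (p₁ * p₁₂ * σ₂ ^ 2 + ρ * σ₁ * σ₂ * p₁₂ * (p₂ - p₁₂))
      / (p₁ * p₂ * σ₂ ^ 2 - ρ ^ 2 * σ₂ ^ 2 * (p₁ - p₁₂) * (p₂ - p₁₂))) :
    0 < p₁ * p₂ * σ₁ ^ 2 - ρ ^ 2 * σ₁ ^ 2 * (p₁ - p₁₂) * (p₂ - p₁₂) ∧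
    0 < p₁ * p₂ * σ₂ ^ 2 - ρ ^ 2 * σ₂ ^ 2 * (p₁ - p₁₂) * (p₂ - p₁₂) ∧
    HasDerivAt (fun w₁ : ℝ =>
      (w₁ ^ 2 / p₁₂ + (1 - w₁) ^ 2 / (p₁ - p₁₂)) * σ₁ ^ 2
        + (w₂s ^ 2 / p₁₂ + (1 - w₂s) ^ 2 / (p₂ - p₁₂)) * σ₂ ^ 2
        - 2 * w₁ * w₂s * ρ * σ₁ * σ₂ / p₁₂) 0 w₁s ∧
    HasDerivAt (fun w₂ : ℝ =>
      (w₁s ^ 2 / p₁₂ + (1 - w₁s) ^ 2 / (p₁ - p₁₂)) * σ₁ ^ 2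
        + (w₂ ^ 2 / p₁₂ + (1 - w₂) ^ 2 / (p₂ - p₁₂)) * σ₂ ^ 2
        - 2 * w₁s * w₂ * ρ * σ₁ * σ₂ / p₁₂) 0 w₂s := by
  have hr : ρ ^ 2 ≤ 1 := by
    rw [← sq_abs]
    exact pow_le_one₀ (abs_nonneg _) hρ
  have ha : 0 < p₁ - p₁₂ := sub_pos.2 hp₁₂lt₁
  have hb : 0 < p₂ - p₁₂ := sub_pos.2 hp₁₂lt₂
  have hD : 0 < p₁ * p₂ - ρ ^ 2 * ((p₁ - p₁₂) * (p₂ - p₁₂)) := by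
    have h1 : ρ ^ 2 * ((p₁ - p₁₂) * (p₂ - p₁₂)) ≤ (p₁ - p₁₂) * (p₂ - p₁₂) :=
      mul_le_of_le_one_left (mul_pos ha hb).le hr
    nlinarith [mul_pos hp₁₂pos ha, mul_pos hp₁₂pos hb, mul_pos hp₁₂pos hp₁₂pos]
  have hD1 : 0 < p₁ * p₂ * σ₁ ^ 2 - ρ ^ 2 * σ₁ ^ 2 * (p₁ - p₁₂) * (p₂ - p₁₂) := by
    have := mul_pos hD (pow_pos hσ₁ 2)
    linarith
  have hD2 : 0 < p₁ * p₂ * σ₂ ^ 2 - ρ ^ 2 * σ₂ ^ 2 * (p₁ - p₁₂) * (p₂ - p₁₂) := by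
    have := mul_pos hD (pow_pos hσ₂ 2)
    linarith
  have e1 : w₁s * (σ₁ * (p₁ * p₂ - ρ ^ 2 * ((p₁ - p₁₂) * (p₂ - p₁₂))))
      = p₂ * p₁₂ * σ₁ + ρ * σ₂ * p₁₂ * (p₁ - p₁₂) := by
    rw [eq_div_iff hD1.ne'] at hw₁s
    apply mul_left_cancel₀ hσ₁.ne'
    linear_combination hw₁s
  have e2 : w₂s * (σ₂ * (p₁ * p₂ - ρ ^ 2 * ((p₁ - p₁₂) * (p₂ - p₁₂))))
      = p₁ * p₁₂ * σ₂ + ρ * σ₁ * p₁₂ * (p₂ - p₁₂) := by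
    rw [eq_div_iff hD2.ne'] at hw₂s
    apply mul_left_cancel₀ hσ₂.ne'
    linear_combination hw₂s
  have f1 : w₁s * p₁ * σ₁ - ρ * σ₂ * (p₁ - p₁₂) * w₂s - p₁₂ * σ₁ = 0 := by
    apply mul_left_cancel₀ hD.ne'
    linear_combination p₁ * e1 - ρ * (p₁ - p₁₂) * e2
  have f2 : w₂s * p₂ * σ₂ - ρ * σ₁ * (p₂ - p₁₂) * w₁s - p₁₂ * σ₂ = 0 := by
    apply mul_left_cancel₀ hD.ne'
    linear_combination p₂ * e2 - ρ * (p₂ - p₁₂) * e1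
  have key : ∀ p σ c k x : ℝ, 0 < p - p₁₂ →
      x * p * σ - k * (p - p₁₂) - p₁₂ * σ = 0 →
      HasDerivAt (fun w : ℝ => (w ^ 2 / p₁₂ + (1 - w) ^ 2 / (p - p₁₂)) * σ ^ 2
        + c - w * (2 * k * σ / p₁₂)) 0 x := by
    intro p σ c k x hp hf
    have h := (((((hasDerivAt_id x).pow 2).div_const p₁₂).add
      ((((hasDerivAt_id x).const_sub 1).pow 2).div_const (p - p₁₂))).mul_const
        (σ ^ 2)).add_const c |>.sub ((hasDerivAt_id x).mul_const (2 * k * σ / p₁₂))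
    refine HasDerivAt.congr_deriv (f := fun w : ℝ => (w ^ 2 / p₁₂ + (1 - w) ^ 2 / (p - p₁₂)) * σ ^ 2 + c - w * (2 * k * σ / p₁₂)) h ?_
    have := hp.ne'
    have := hp₁₂pos.ne'
    simp only [id, Nat.add_one_sub_one, pow_one, Nat.cast_ofNat]
    field_simp
    linear_combination (2 * σ) * hf
  refine ⟨hD1, hD2, ?_, ?_⟩
  · convert key p₁ σ₁ ((w₂s ^ 2 / p₁₂ + (1 - w₂s) ^ 2 / (p₂ - p₁₂)) * σ₂ ^ 2)
      (ρ * σ₂ * w₂s) w₁s ha (by linear_combination f1) using 2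
    ring
  · convert key p₂ σ₂ ((w₁s ^ 2 / p₁₂ + (1 - w₁s) ^ 2 / (p₁ - p₁₂)) * σ₁ ^ 2)
      (ρ * σ₁ * w₁s) w₂s hb (by linear_combination f2) using 2
    ring
end

section
/- If σ₁ > 0, σ₂ > 0 and |ρ| ≤ 1, then (w₁*, w₂*) is a global minimizer of σ_D² over ℝ²: for all real w₁, w₂, σ_D²(w₁*, w₂*) ≤ σ_D²(w₁, w₂). -/
/-- (w₁*, w₂*) is a global minimizer of σ_D² over ℝ². -/
theorem sigmaD_sq_global_min_at_wstar (p₁ p₂ p₁₂ σ₁ σ₂ ρ : ℝ)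
    (hp₁₂pos : 0 < p₁₂) (hp₁₂lt₁ : p₁₂ < p₁) (hp₁le : p₁ ≤ 1)
    (hp₁₂lt₂ : p₁₂ < p₂) (hp₂le : p₂ ≤ 1)
    (hσ₁ : 0 < σ₁) (hσ₂ : 0 < σ₂) (hρ : |ρ| ≤ 1)
    (f : ℝ → ℝ → ℝ)
    (hf : ∀ w₁ w₂, f w₁ w₂ = (w₁ ^ 2 / p₁₂ + (1 - w₁) ^ 2 / (p₁ - p₁₂)) * σ₁ ^ 2
        + (w₂ ^ 2 / p₁₂ + (1 - w₂) ^ 2 / (p₂ - p₁₂)) * σ₂ ^ 2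
        - 2 * w₁ * w₂ * ρ * σ₁ * σ₂ / p₁₂)
    (w₁s w₂s : ℝ)
    (hw₁s : w₁s = (p₂ * p₁₂ * σ₁ ^ 2 + ρ * σ₁ * σ₂ * p₁₂ * (p₁ - p₁₂))
      / (p₁ * p₂ * σ₁ ^ 2 - ρ ^ 2 * σ₁ ^ 2 * (p₁ - p₁₂) * (p₂ - p₁₂)))
    (hw₂s : w₂s = (p₁ * p₁₂ * σ₂ ^ 2 + ρ * σ₁ * σ₂ * p₁₂ * (p₂ - p₁₂))
      / (p₁ * p₂ * σ₂ ^ 2 - ρ ^ 2 * σ₂ ^ 2 * (p₁ - p₁₂) * (p₂ - p₁₂))) :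
    ∀ w₁ w₂ : ℝ, f w₁s w₂s ≤ f w₁ w₂ := by
  obtain ⟨a, rfl⟩ : ∃ a, p₁ = p₁₂ + a := ⟨p₁ - p₁₂, by ring⟩
  obtain ⟨b, rfl⟩ : ∃ b, p₂ = p₁₂ + b := ⟨p₂ - p₁₂, by ring⟩
  have ha : 0 < a := by linarith
  have hb : 0 < b := by linarith
  simp only [add_sub_cancel_left] at hf hw₁s hw₂s
  have hρ2 : ρ ^ 2 ≤ 1 := (sq_le_one_iff_abs_le_one ρ).2 hρ
  have hD : 0 < (p₁₂ + a) * (p₁₂ + b) - ρ ^ 2 * a * b := by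
    have h1 : ρ ^ 2 * (a * b) ≤ 1 * (a * b) :=
      mul_le_mul_of_nonneg_right hρ2 (by positivity)
    have h2 : 0 < p₁₂ * p₁₂ + p₁₂ * a + p₁₂ * b := by positivity
    nlinarith
  have e1 : w₁s * (σ₁ * ((p₁₂ + a) * (p₁₂ + b) - ρ ^ 2 * a * b))
      = p₁₂ * (σ₁ * (p₁₂ + b) + ρ * σ₂ * a) := by
    have h : (p₁₂ + a) * (p₁₂ + b) * σ₁ ^ 2 - ρ ^ 2 * σ₁ ^ 2 * a * b
      = σ₁ * (σ₁ * ((p₁₂ + a) * (p₁₂ + b) - ρ ^ 2 * a * b)) := by ring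
    rw [hw₁s, h]
    have := hD.ne'
    generalize (p₁₂ + a) * (p₁₂ + b) - ρ ^ 2 * a * b = D at this ⊢
    field_simp
  have e2 : w₂s * (σ₂ * ((p₁₂ + a) * (p₁₂ + b) - ρ ^ 2 * a * b))
      = p₁₂ * (σ₂ * (p₁₂ + a) + ρ * σ₁ * b) := by
    have h : (p₁₂ + a) * (p₁₂ + b) * σ₂ ^ 2 - ρ ^ 2 * σ₂ ^ 2 * a * b
      = σ₂ * (σ₂ * ((p₁₂ + a) * (p₁₂ + b) - ρ ^ 2 * a * b)) := by ring
    rw [hw₂s, h]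
    have := hD.ne'
    generalize (p₁₂ + a) * (p₁₂ + b) - ρ ^ 2 * a * b = D at this ⊢
    field_simp
  have c1 : σ₁ * (p₁₂ + a) * w₁s - ρ * σ₂ * a * w₂s - σ₁ * p₁₂ = 0 := by
    refine (mul_eq_zero.1 ?_).resolve_right hD.ne'
    linear_combination (p₁₂ + a) * e1 - ρ * a * e2
  have c2 : σ₂ * (p₁₂ + b) * w₂s - ρ * σ₁ * b * w₁s - σ₂ * p₁₂ = 0 := by
    refine (mul_eq_zero.1 ?_).resolve_right hD.ne'
    linear_combination (p₁₂ + b) * e2 - ρ * b * e1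
  clear hw₁s hw₂s e1 e2
  intro w₁ w₂
  have key : f w₁ w₂ - f w₁s w₂s =
      ((σ₁ * (w₁ - w₁s) - ρ * (σ₂ * (w₂ - w₂s))) ^ 2
        + (1 - ρ ^ 2) * (σ₂ * (w₂ - w₂s)) ^ 2) / p₁₂
      + (σ₁ * (w₁ - w₁s)) ^ 2 / a + (σ₂ * (w₂ - w₂s)) ^ 2 / b
      + 2 * σ₁ * (w₁ - w₁s) / (p₁₂ * a)
        * (σ₁ * (p₁₂ + a) * w₁s - ρ * σ₂ * a * w₂s - σ₁ * p₁₂)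
      + 2 * σ₂ * (w₂ - w₂s) / (p₁₂ * b)
        * (σ₂ * (p₁₂ + b) * w₂s - ρ * σ₁ * b * w₁s - σ₂ * p₁₂) := by
    rw [hf, hf]
    field_simp
    ring
  rw [c1, c2] at key
  have h1 : 0 ≤ 1 - ρ ^ 2 := by linarith
  have h2 : 0 ≤ ((σ₁ * (w₁ - w₁s) - ρ * (σ₂ * (w₂ - w₂s))) ^ 2
        + (1 - ρ ^ 2) * (σ₂ * (w₂ - w₂s)) ^ 2) / p₁₂
      + (σ₁ * (w₁ - w₁s)) ^ 2 / a + (σ₂ * (w₂ - w₂s)) ^ 2 / b := by positivity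
  linarith
end

section
/- If σ₁ > 0, σ₂ > 0, |ρ| ≤ 1, and 0 ≤ w₁* ≤ 1 and 0 ≤ w₂* ≤ 1, then (w₁*, w₂*) minimizes σ_D² over the unit square: for all w₁, w₂ ∈ [0,1], σ_D²(w₁*, w₂*) ≤ σ_D²(w₁, w₂). -/
/-- if additionally (w₁*, w₂*) lies in the unit square, it minimizes σ_D² over
the unit square. -/
theorem sigmaD_sq_min_on_unit_square_at_wstar (p₁ p₂ p₁₂ σ₁ σ₂ ρ : ℝ)
    (hp₁₂pos : 0 < p₁₂) (hp₁₂lt₁ : p₁₂ < p₁) (hp₁le : p₁ ≤ 1)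
    (hp₁₂lt₂ : p₁₂ < p₂) (hp₂le : p₂ ≤ 1)
    (hσ₁ : 0 < σ₁) (hσ₂ : 0 < σ₂) (hρ : |ρ| ≤ 1)
    (f : ℝ → ℝ → ℝ)
    (hf : ∀ w₁ w₂, f w₁ w₂ = (w₁ ^ 2 / p₁₂ + (1 - w₁) ^ 2 / (p₁ - p₁₂)) * σ₁ ^ 2
        + (w₂ ^ 2 / p₁₂ + (1 - w₂) ^ 2 / (p₂ - p₁₂)) * σ₂ ^ 2
        - 2 * w₁ * w₂ * ρ * σ₁ * σ₂ / p₁₂)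
    (w₁s w₂s : ℝ)
    (hw₁s : w₁s = (p₂ * p₁₂ * σ₁ ^ 2 + ρ * σ₁ * σ₂ * p₁₂ * (p₁ - p₁₂))
      / (p₁ * p₂ * σ₁ ^ 2 - ρ ^ 2 * σ₁ ^ 2 * (p₁ - p₁₂) * (p₂ - p₁₂)))
    (hw₂s : w₂s = (p₁ * p₁₂ * σ₂ ^ 2 + ρ * σ₁ * σ₂ * p₁₂ * (p₂ - p₁₂))
      / (p₁ * p₂ * σ₂ ^ 2 - ρ ^ 2 * σ₂ ^ 2 * (p₁ - p₁₂) * (p₂ - p₁₂)))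
    (hw₁s01 : w₁s ∈ Set.Icc (0 : ℝ) 1) (hw₂s01 : w₂s ∈ Set.Icc (0 : ℝ) 1) :
    ∀ w₁ ∈ Set.Icc (0 : ℝ) 1, ∀ w₂ ∈ Set.Icc (0 : ℝ) 1, f w₁s w₂s ≤ f w₁ w₂ := by
  intro w₁ _ w₂ _
  obtain ⟨a, ha⟩ : ∃ a, a = p₁ - p₁₂ := ⟨_, rfl⟩
  obtain ⟨b, hb⟩ : ∃ b, b = p₂ - p₁₂ := ⟨_, rfl⟩
  have ha0 : 0 < a := by linarith
  have hb0 : 0 < b := by linarith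
  have hp1 : p₁ = a + p₁₂ := by linarith
  have hp2 : p₂ = b + p₁₂ := by linarith
  have hr2 : ρ ^ 2 ≤ 1 := (sq_le_one_iff_abs_le_one ρ).mpr hρ
  have hab : 0 < a * b := mul_pos ha0 hb0
  have hD : 0 < p₁ * p₂ - ρ ^ 2 * a * b := by
    have h1 : ρ ^ 2 * (a * b) ≤ 1 * (a * b) := mul_le_mul_of_nonneg_right hr2 hab.le
    rw [hp1, hp2]
    nlinarith [mul_pos ha0 hp₁₂pos, mul_pos hb0 hp₁₂pos, mul_pos hp₁₂pos hp₁₂pos]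
  have e1 : w₁s * (σ₁ * (p₁ * p₂ - ρ ^ 2 * a * b)) = p₁₂ * (p₂ * σ₁ + ρ * σ₂ * a) := by
    have hne : p₁ * p₂ * σ₁ ^ 2 - ρ ^ 2 * σ₁ ^ 2 * a * b ≠ 0 := by
      have : 0 < σ₁ ^ 2 * (p₁ * p₂ - ρ ^ 2 * a * b) := by positivity
      intro h; nlinarith
    rw [← ha, ← hb, eq_div_iff hne] at hw₁s
    apply mul_left_cancel₀ hσ₁.ne'
    linear_combination hw₁s
  have e2 : w₂s * (σ₂ * (p₁ * p₂ - ρ ^ 2 * a * b)) = p₁₂ * (p₁ * σ₂ + ρ * σ₁ * b) := by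
    have hne : p₁ * p₂ * σ₂ ^ 2 - ρ ^ 2 * σ₂ ^ 2 * a * b ≠ 0 := by
      have : 0 < σ₂ ^ 2 * (p₁ * p₂ - ρ ^ 2 * a * b) := by positivity
      intro h; nlinarith
    rw [← ha, ← hb, eq_div_iff hne] at hw₂s
    apply mul_left_cancel₀ hσ₂.ne'
    linear_combination hw₂s
  have E1 : p₁ * σ₁ * w₁s - a * ρ * σ₂ * w₂s = p₁₂ * σ₁ := by
    apply mul_left_cancel₀ hD.ne'
    linear_combination p₁ * e1 - a * ρ * e2
  have E2 : p₂ * σ₂ * w₂s - b * ρ * σ₁ * w₁s = p₁₂ * σ₂ := by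
    apply mul_left_cancel₀ hD.ne'
    linear_combination p₂ * e2 - b * ρ * e1
  have key : f w₁ w₂ - f w₁s w₂s =
      ((σ₁ * (w₁ - w₁s) - ρ * (σ₂ * (w₂ - w₂s))) ^ 2
        + (1 - ρ ^ 2) * (σ₂ * (w₂ - w₂s)) ^ 2) / p₁₂
      + (σ₁ * (w₁ - w₁s)) ^ 2 / a + (σ₂ * (w₂ - w₂s)) ^ 2 / b := by
    rw [hf, hf, ← ha, ← hb]
    rw [hp1] at E1
    rw [hp2] at E2
    field_simp
    linear_combination 2 * b * σ₁ * (w₁ - w₁s) * E1 + 2 * a * σ₂ * (w₂ - w₂s) * E2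
  have hr : 0 ≤ 1 - ρ ^ 2 := by linarith
  have : 0 ≤ f w₁ w₂ - f w₁s w₂s := by
    rw [key]
    positivity
  linarith
end

section
/- Suppose σ₁ > 0, σ₂ > 0 and |ρ| ≤ 1. On the boundary line w₁ = 1 of the unit square, the function w₂ ↦ σ_D²(1, w₂) is minimized over [0,1] at w₂ = g((p₁₂σ₂ + ρσ₁(p₂-p₁₂))/(p₂σ₂)): for all w₂ ∈ [0,1], σ_D²(1, g((p₁₂σ₂ + ρσ₁(p₂-p₁₂))/(p₂σ₂))) ≤ σ_D²(1, w₂). -/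
/-- on the boundary line w₁ = 1, w₂ ↦ σ_D²(1, w₂) is minimized over [0,1]
at w₂ = g((p₁₂σ₂ + ρσ₁(p₂-p₁₂))/(p₂σ₂)), where g is the clamp to [0,1]. -/
theorem sigmaD_sq_min_on_w1_eq_one (p₁ p₂ p₁₂ σ₁ σ₂ ρ : ℝ)
    (hp₁₂pos : 0 < p₁₂) (hp₁₂lt₁ : p₁₂ < p₁) (hp₁le : p₁ ≤ 1)
    (hp₁₂lt₂ : p₁₂ < p₂) (hp₂le : p₂ ≤ 1)
    (hσ₁ : 0 < σ₁) (hσ₂ : 0 < σ₂) (hρ : |ρ| ≤ 1)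
    (f : ℝ → ℝ → ℝ)
    (hf : ∀ w₁ w₂, f w₁ w₂ = (w₁ ^ 2 / p₁₂ + (1 - w₁) ^ 2 / (p₁ - p₁₂)) * σ₁ ^ 2
        + (w₂ ^ 2 / p₁₂ + (1 - w₂) ^ 2 / (p₂ - p₁₂)) * σ₂ ^ 2
        - 2 * w₁ * w₂ * ρ * σ₁ * σ₂ / p₁₂)
    (g : ℝ → ℝ)
    (hg0 : ∀ z : ℝ, z < 0 → g z = 0)
    (hgz : ∀ z : ℝ, 0 ≤ z → z ≤ 1 → g z = z)
    (hg1 : ∀ z : ℝ, 1 < z → g z = 1) :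
    ∀ w₂ ∈ Set.Icc (0 : ℝ) 1,
      f 1 (g ((p₁₂ * σ₂ + ρ * σ₁ * (p₂ - p₁₂)) / (p₂ * σ₂))) ≤ f 1 w₂ := by
  intro w hw
  obtain ⟨h0, h1⟩ := hw
  have hq : 0 < p₂ - p₁₂ := sub_pos.mpr hp₁₂lt₂
  have hp₂ : 0 < p₂ := hp₁₂pos.trans hp₁₂lt₂
  obtain ⟨z, hz⟩ : ∃ z, z = (p₁₂ * σ₂ + ρ * σ₁ * (p₂ - p₁₂)) / (p₂ * σ₂) := ⟨_, rfl⟩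
  rw [← hz]
  have hz' : ρ * σ₁ = (z * (p₂ * σ₂) - p₁₂ * σ₂) / (p₂ - p₁₂) := by
    rw [hz]
    field_simp
    ring
  have key : ∀ a b, f 1 b - f 1 a
      = p₂ * σ₂ ^ 2 / (p₁₂ * (p₂ - p₁₂)) * ((b - z) ^ 2 - (a - z) ^ 2) := by
    intro a b
    have e : ∀ w : ℝ, 2 * 1 * w * ρ * σ₁ * σ₂ / p₁₂ = 2 * w * (ρ * σ₁) * σ₂ / p₁₂ := by
      intro w
      ring
    rw [hf, hf, e, e, hz']
    obtain ⟨q, hq'⟩ : ∃ q, q = p₂ - p₁₂ := ⟨_, rfl⟩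
    have hp : p₂ = q + p₁₂ := by linarith
    rw [← hq'] at hq ⊢
    rw [hp]
    have := hq.ne'
    have := hp₁₂pos.ne'
    generalize (1 ^ 2 / p₁₂ + (1 - 1) ^ 2 / (p₁ - p₁₂)) * σ₁ ^ 2 = C
    field_simp
    ring
  have hK : 0 ≤ p₂ * σ₂ ^ 2 / (p₁₂ * (p₂ - p₁₂)) := by positivity
  rw [← sub_nonneg, key]
  apply mul_nonneg hK
  rcases lt_or_ge z 0 with h | h
  · rw [hg0 z h]
    nlinarith
  · rcases le_or_gt z 1 with h' | h'
    · rw [hgz z h h']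
      nlinarith [sq_nonneg (w - z)]
    · rw [hg1 z h']
      nlinarith
end

section
/- Suppose σ₁ > 0, σ₂ > 0 and |ρ| ≤ 1. On the boundary line w₂ = 1 of the unit square, the function w₁ ↦ σ_D²(w₁, 1) is minimized over [0,1] at w₁ = g((p₁₂σ₁ + ρσ₂(p₁-p₁₂))/(p₁σ₁)): for all w₁ ∈ [0,1], σ_D²(g((p₁₂σ₁ + ρσ₂(p₁-p₁₂))/(p₁σ₁)), 1) ≤ σ_D²(w₁, 1). -/
/-- on the boundary line w₂ = 1, w₁ ↦ σ_D²(w₁, 1) is minimized over [0,1]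
at w₁ = g((p₁₂σ₁ + ρσ₂(p₁-p₁₂))/(p₁σ₁)), where g is the clamp to [0,1]. -/
theorem sigmaD_sq_min_on_w2_eq_one (p₁ p₂ p₁₂ σ₁ σ₂ ρ : ℝ)
    (hp₁₂pos : 0 < p₁₂) (hp₁₂lt₁ : p₁₂ < p₁) (hp₁le : p₁ ≤ 1)
    (hp₁₂lt₂ : p₁₂ < p₂) (hp₂le : p₂ ≤ 1)
    (hσ₁ : 0 < σ₁) (hσ₂ : 0 < σ₂) (hρ : |ρ| ≤ 1)
    (f : ℝ → ℝ → ℝ)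
    (hf : ∀ w₁ w₂, f w₁ w₂ = (w₁ ^ 2 / p₁₂ + (1 - w₁) ^ 2 / (p₁ - p₁₂)) * σ₁ ^ 2
        + (w₂ ^ 2 / p₁₂ + (1 - w₂) ^ 2 / (p₂ - p₁₂)) * σ₂ ^ 2
        - 2 * w₁ * w₂ * ρ * σ₁ * σ₂ / p₁₂)
    (g : ℝ → ℝ)
    (hg0 : ∀ z : ℝ, z < 0 → g z = 0)
    (hgz : ∀ z : ℝ, 0 ≤ z → z ≤ 1 → g z = z)
    (hg1 : ∀ z : ℝ, 1 < z → g z = 1) :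
    ∀ w₁ ∈ Set.Icc (0 : ℝ) 1,
      f (g ((p₁₂ * σ₁ + ρ * σ₂ * (p₁ - p₁₂)) / (p₁ * σ₁))) 1 ≤ f w₁ 1 := by
  intro w hw
  obtain ⟨hw0, hw1⟩ := hw
  have hd : 0 < p₁ - p₁₂ := sub_pos.mpr hp₁₂lt₁
  have hp : 0 < p₁ := hp₁₂pos.trans hp₁₂lt₁
  obtain ⟨z, hz⟩ : ∃ z, z = (p₁₂ * σ₁ + ρ * σ₂ * (p₁ - p₁₂)) / (p₁ * σ₁) := ⟨_, rfl⟩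
  have key : ∀ u : ℝ, f w 1 - f u 1
      = p₁ * σ₁ ^ 2 / (p₁₂ * (p₁ - p₁₂)) * ((w - z) ^ 2 - (u - z) ^ 2) := by
    intro u
    have hd' : p₁ - p₁₂ ≠ 0 := hd.ne'
    rw [hf, hf, hz]
    obtain ⟨d, hdd⟩ : ∃ d, d = p₁ - p₁₂ := ⟨_, rfl⟩
    have h2 : p₁ = p₁₂ + d := by linarith
    have h3 : p₁₂ + d ≠ 0 := by rw [← h2]; exact hp.ne'
    rw [← hdd] at hd' ⊢
    rw [h2]
    have := hp₁₂pos.ne'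
    have := hσ₁.ne'
    field_simp
    ring
  rw [← hz]
  have hK : 0 < p₁ * σ₁ ^ 2 / (p₁₂ * (p₁ - p₁₂)) := by positivity
  have main : (g z - z) ^ 2 ≤ (w - z) ^ 2 := by
    rcases lt_or_ge z 0 with h | h
    · rw [hg0 z h]; nlinarith
    · rcases le_or_gt z 1 with h1 | h1
      · rw [hgz z h h1]; nlinarith [sq_nonneg (w - z)]
      · rw [hg1 z h1]; nlinarith
  have h4 := key (g z)
  have h5 := mul_nonneg hK.le (sub_nonneg.mpr main)
  linarith
end

section
/- Suppose σ₁ > 0, σ₂ > 0 and |ρ| ≤ 1. The function V(w₂) = σ₁²/p₁ + {w₂²/p₁ + (1-w₂)²/(1-p₁)}σ₂² - 2w₂ρσ₁σ₂/p₁ is minimized over [0,1] at w₂ = g(p₁ + ρ(σ₁/σ₂)(1-p₁)): for all w₂ ∈ [0,1], V(g(p₁ + ρ(σ₁/σ₂)(1-p₁))) ≤ V(w₂). -/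
/-- when missing values are present only in group 1, the asymptotic variance
V(w₂) = σ₁²/p₁ + {w₂²/p₁ + (1-w₂)²/(1-p₁)}σ₂² - 2w₂ρσ₁σ₂/p₁ is minimized over [0,1]
at w₂ = g(p₁ + ρ(σ₁/σ₂)(1-p₁)), where g is the clamp to [0,1]. -/
theorem variance_min_missing_group1 (p₁ σ₁ σ₂ ρ : ℝ)
    (hp₁pos : 0 < p₁) (hp₁lt : p₁ < 1)
    (hσ₁ : 0 < σ₁) (hσ₂ : 0 < σ₂) (hρ : |ρ| ≤ 1)
    (V : ℝ → ℝ)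
    (hV : ∀ w₂, V w₂ = σ₁ ^ 2 / p₁ + (w₂ ^ 2 / p₁ + (1 - w₂) ^ 2 / (1 - p₁)) * σ₂ ^ 2
        - 2 * w₂ * ρ * σ₁ * σ₂ / p₁)
    (g : ℝ → ℝ)
    (hg0 : ∀ z : ℝ, z < 0 → g z = 0)
    (hgz : ∀ z : ℝ, 0 ≤ z → z ≤ 1 → g z = z)
    (hg1 : ∀ z : ℝ, 1 < z → g z = 1) :
    ∀ w₂ ∈ Set.Icc (0 : ℝ) 1, V (g (p₁ + ρ * (σ₁ / σ₂) * (1 - p₁))) ≤ V w₂ := by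
  intro w hw
  obtain ⟨hw0, hw1⟩ := hw
  have hq : 0 < 1 - p₁ := by linarith
  have key : ∀ z u : ℝ, z = p₁ + ρ * (σ₁ / σ₂) * (1 - p₁) →
      V w - V u = σ₂ ^ 2 / (p₁ * (1 - p₁)) * ((w - z) ^ 2 - (u - z) ^ 2) := by
    intro z u hz
    rw [hV, hV, hz]
    have h1 := hp₁pos.ne'
    have h2 := hq.ne'
    have h3 := hσ₂.ne'
    field_simp
    ring
  generalize hz : p₁ + ρ * (σ₁ / σ₂) * (1 - p₁) = z at *
  have hk := key z (g z) rfl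
  have hc : 0 ≤ σ₂ ^ 2 / (p₁ * (1 - p₁)) := by positivity
  have hd : 0 ≤ (w - z) ^ 2 - (g z - z) ^ 2 := by
    rcases lt_or_ge z 0 with h | h
    · rw [hg0 z h]; nlinarith
    · rcases le_or_gt z 1 with h' | h'
      · rw [hgz z h h']; nlinarith [sq_nonneg (w - z)]
      · rw [hg1 z h']; nlinarith
  have := mul_nonneg hc hd
  linarith
end

section
/- Suppose σ₁ > 0, σ₂ > 0 and |ρ| ≤ 1. The function V(w₁) = {w₁²/p₂ + (1-w₁)²/(1-p₂)}σ₁² + σ₂²/p₂ - 2w₁ρσ₁σ₂/p₂ is minimized over [0,1] at w₁ = g(p₂ + ρ(σ₂/σ₁)(1-p₂)): for all w₁ ∈ [0,1], V(g(p₂ + ρ(σ₂/σ₁)(1-p₂))) ≤ V(w₁). -/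
/-- when missing values are present only in group 2, the asymptotic variance
V(w₁) = {w₁²/p₂ + (1-w₁)²/(1-p₂)}σ₁² + σ₂²/p₂ - 2w₁ρσ₁σ₂/p₂ is minimized over [0,1]
at w₁ = g(p₂ + ρ(σ₂/σ₁)(1-p₂)), where g is the clamp to [0,1]. -/
theorem variance_min_missing_group2 (p₂ σ₁ σ₂ ρ : ℝ)
    (hp₂pos : 0 < p₂) (hp₂lt : p₂ < 1)
    (hσ₁ : 0 < σ₁) (hσ₂ : 0 < σ₂) (hρ : |ρ| ≤ 1)
    (V : ℝ → ℝ)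
    (hV : ∀ w₁, V w₁ = (w₁ ^ 2 / p₂ + (1 - w₁) ^ 2 / (1 - p₂)) * σ₁ ^ 2 + σ₂ ^ 2 / p₂
        - 2 * w₁ * ρ * σ₁ * σ₂ / p₂)
    (g : ℝ → ℝ)
    (hg0 : ∀ z : ℝ, z < 0 → g z = 0)
    (hgz : ∀ z : ℝ, 0 ≤ z → z ≤ 1 → g z = z)
    (hg1 : ∀ z : ℝ, 1 < z → g z = 1) :
    ∀ w₁ ∈ Set.Icc (0 : ℝ) 1, V (g (p₂ + ρ * (σ₂ / σ₁) * (1 - p₂))) ≤ V w₁ := by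
  intro w hw
  obtain ⟨hw0, hw1⟩ := hw
  have hq : 0 < 1 - p₂ := by linarith
  obtain ⟨z, hz⟩ : ∃ z, z = p₂ + ρ * (σ₂ / σ₁) * (1 - p₂) := ⟨_, rfl⟩
  have key : ∀ u, V w - V u = σ₁ ^ 2 / (p₂ * (1 - p₂)) * ((w - u) * (w + u - 2 * z)) := by
    intro u
    rw [hV, hV, hz]
    have h1 := hσ₁.ne'
    have h2 := hp₂pos.ne'
    have h3 := hq.ne'
    field_simp
    ring
  have hc : 0 ≤ σ₁ ^ 2 / (p₂ * (1 - p₂)) := by positivity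
  rw [← hz]
  have main : 0 ≤ (w - g z) * (w + g z - 2 * z) := by
    rcases lt_or_ge z 0 with h | h
    · rw [hg0 z h]
      exact mul_nonneg (by linarith) (by linarith)
    · rcases lt_or_ge 1 z with h' | h'
      · rw [hg1 z h']
        exact mul_nonneg_of_nonpos_of_nonpos (by linarith) (by linarith)
      · rw [hgz z h h']
        nlinarith [sq_nonneg (w - z)]
  have := mul_nonneg hc main
  rw [← key] at this
  linarith
end
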